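/- Fix an integer d ≥ 2 and α ∈ [0,1], and let ρ_W be the Werner state with parameter α on ℂ^d ⊗ ℂ^d. Then (Tr[(ρ_W^{T_A})²])² > Tr[(ρ_W^{T_A})³] if and only if α < 1/2. (Equivalently, the Werner state violates the p3-PPT condition exactly when it violates the PPT condition, namely for 0 ≤ α < 1/2.) -/

import Mathlib

/-- Partial transpose on the `A` factor:
`(X^{T_A})_{(a,b),(a',b')} = X_{(a',b),(a,b')}`. -/
def partialTransposeA {A B : Type*} (X : Matrix (A × B) (A × B) ℂ) :
    Matrix (A × B) (A × B) ℂ :=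
  fun p q => X (q.1, p.2) (p.1, q.2)

/-- The swap matrix on `ℂ^d ⊗ ℂ^d`: `S_{(i,j),(k,l)} = δ_{i,l} δ_{j,k}`. -/
def swapMatrix (d : ℕ) : Matrix (Fin d × Fin d) (Fin d × Fin d) ℂ :=
  fun p q => if p.1 = q.2 ∧ p.2 = q.1 then 1 else 0

/-- The projector `Π₊ = (I + S)/2` onto the symmetric subspace. -/
noncomputable def symProj (d : ℕ) : Matrix (Fin d × Fin d) (Fin d × Fin d) ℂ :=
  (2 : ℂ)⁻¹ • (1 + swapMatrix d)

/-- The projector `Π₋ = (I − S)/2` onto the antisymmetric subspace. -/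
noncomputable def antisymProj (d : ℕ) : Matrix (Fin d × Fin d) (Fin d × Fin d) ℂ :=
  (2 : ℂ)⁻¹ • (1 - swapMatrix d)

/-- The Werner state with parameter `α`:
`ρ_W = α·Π₊/(d(d+1)/2) + (1−α)·Π₋/(d(d−1)/2)`. -/
noncomputable def wernerState (d : ℕ) (α : ℝ) :
    Matrix (Fin d × Fin d) (Fin d × Fin d) ℂ :=
  ((α : ℂ) / ((d : ℂ) * ((d : ℂ) + 1) / 2)) • symProj d +
    (((1 - α : ℝ) : ℂ) / ((d : ℂ) * ((d : ℂ) - 1) / 2)) • antisymProj d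

/-- The projector onto the maximally entangled state:
`(Δ₀)_{(i,j),(k,l)} = δ_{i,j} δ_{k,l} / d`. -/
noncomputable def maxEntProj (d : ℕ) : Matrix (Fin d × Fin d) (Fin d × Fin d) ℂ :=
  fun p q => (if p.1 = p.2 ∧ q.1 = q.2 then 1 else 0) / (d : ℂ)

/-- The unnormalized maximally entangled projector. -/
def auxK (d : ℕ) : Matrix (Fin d × Fin d) (Fin d × Fin d) ℂ :=
  fun p q => if p.1 = p.2 ∧ q.1 = q.2 then 1 else 0

lemma auxK_trace (d : ℕ) : (auxK d).trace = d := by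
  simp only [Matrix.trace, auxK, Matrix.diag_apply, and_self, Fintype.sum_prod_type]
  simp

lemma auxK_mul (d : ℕ) : auxK d * auxK d = (d : ℂ) • auxK d := by
  ext p q
  by_cases hp : p.1 = p.2 <;> by_cases hq : q.1 = q.2 <;>
    simp [Matrix.mul_apply, auxK, Fintype.sum_prod_type, hp, hq]

lemma pt_werner (d : ℕ) (α : ℝ) :
    partialTransposeA (wernerState d α) =
      (((α / (d * (d + 1)) + (1 - α) / (d * (d - 1)) : ℝ)) : ℂ) • 1 +
      (((α / (d * (d + 1)) - (1 - α) / (d * (d - 1)) : ℝ)) : ℂ) • auxK d := by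
  ext p q
  have h1 : (1 : Matrix (Fin d × Fin d) (Fin d × Fin d) ℂ) (q.1, p.2) (p.1, q.2)
      = (1 : Matrix (Fin d × Fin d) (Fin d × Fin d) ℂ) p q := by
    simp only [Matrix.one_apply, Prod.ext_iff]
    congr 1
    simp [eq_comm]
  have h2 : swapMatrix d (q.1, p.2) (p.1, q.2) = auxK d p q := by
    simp only [swapMatrix, auxK]
    congr 1
    simp only [eq_iff_iff]
    exact ⟨fun h => ⟨h.2.symm, h.1⟩, fun h => ⟨h.2, h.1.symm⟩⟩
  simp only [partialTransposeA, wernerState, symProj, antisymProj, Matrix.add_apply,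
    Matrix.smul_apply, Matrix.sub_apply, smul_eq_mul, h1, h2]
  simp only [div_div_eq_mul_div]
  push_cast
  ring

lemma tr_two (d : ℕ) (x y : ℂ) :
    ((x • (1 : Matrix (Fin d × Fin d) (Fin d × Fin d) ℂ) + y • auxK d) ^ 2).trace
      = d ^ 2 * x ^ 2 + d * (2 * x * y + d * y ^ 2) := by
  have : (x • (1 : Matrix (Fin d × Fin d) (Fin d × Fin d) ℂ) + y • auxK d) ^ 2
      = x ^ 2 • 1 + (2 * x * y + d * y ^ 2) • auxK d := by
    simp only [pow_two, add_mul, mul_add, smul_mul_assoc, mul_smul_comm, one_mul, mul_one,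
      auxK_mul]
    module
  rw [this]
  simp [Matrix.trace_add, Matrix.trace_smul, auxK_trace]
  ring

lemma tr_three (d : ℕ) (x y : ℂ) :
    ((x • (1 : Matrix (Fin d × Fin d) (Fin d × Fin d) ℂ) + y • auxK d) ^ 3).trace
      = d ^ 2 * x ^ 3 + d * (3 * x ^ 2 * y + 3 * d * x * y ^ 2 + d ^ 2 * y ^ 3) := by
  have : (x • (1 : Matrix (Fin d × Fin d) (Fin d × Fin d) ℂ) + y • auxK d) ^ 3
      = x ^ 3 • 1 + (3 * x ^ 2 * y + 3 * d * x * y ^ 2 + d ^ 2 * y ^ 3) • auxK d := by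
    simp only [pow_succ, pow_zero, add_mul, mul_add, smul_mul_assoc, mul_smul_comm, one_mul,
      mul_one, auxK_mul, smul_add]
    module
  rw [this]
  simp [Matrix.trace_add, Matrix.trace_smul, auxK_trace]
  ring

/-- **The `p3`-PPT condition is equivalent to the PPT condition for Werner states.**
For `d ≥ 2` and `α ∈ [0,1]`, the Werner state satisfies
`(Tr[(ρ_W^{T_A})²])² > Tr[(ρ_W^{T_A})³]` if and only if `α < 1/2`. -/
theorem wernerState_p3PPT_iff (d : ℕ) (hd : 2 ≤ d) (α : ℝ)
    (hα : α ∈ Set.Icc (0 : ℝ) 1) :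
    ∃ p₂ p₃ : ℝ,
      ((partialTransposeA (wernerState d α)) ^ 2).trace = (p₂ : ℂ) ∧
      ((partialTransposeA (wernerState d α)) ^ 3).trace = (p₃ : ℂ) ∧
      (p₂ ^ 2 > p₃ ↔ α < 1 / 2) := by
  obtain ⟨h0, h1⟩ := hα
  have hD : (2 : ℝ) ≤ d := by exact_mod_cast hd
  rw [pt_werner]
  generalize hx : α / ((d : ℝ) * (d + 1)) + (1 - α) / (d * (d - 1)) = x
  generalize hy : α / ((d : ℝ) * (d + 1)) - (1 - α) / (d * (d - 1)) = y
  refine ⟨d ^ 2 * x ^ 2 + d * (2 * x * y + d * y ^ 2),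
    d ^ 2 * x ^ 3 + d * (3 * x ^ 2 * y + 3 * d * x * y ^ 2 + d ^ 2 * y ^ 3), ?_, ?_, ?_⟩
  · rw [tr_two]; push_cast; ring
  · rw [tr_three]; push_cast; ring
  generalize (d : ℝ) = D at *
  have hD0 : D ≠ 0 := by positivity
  have hD1 : D - 1 ≠ 0 := by intro h; linarith
  have hD2 : D + 1 ≠ 0 := by positivity
  -- `e` is the special eigenvalue; `x` has multiplicity `D ^ 2 - 1`
  obtain ⟨e, he⟩ : ∃ e, e = x + D * y := ⟨_, rfl⟩
  have hDe : D * e = 2 * α - 1 := by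
    rw [he, ← hx, ← hy]; field_simp; ring
  have htr : (D ^ 2 - 1) * x = 1 - e := by
    rw [he, ← hx, ← hy]; field_simp; ring
  have hn : 0 < D ^ 2 - 1 := by nlinarith
  have h2 : D ^ 2 * x ^ 2 + D * (2 * x * y + D * y ^ 2) = (1 - e) * x + e ^ 2 := by
    rw [← htr, he]; ring
  have h3 : D ^ 2 * x ^ 3 + D * (3 * x ^ 2 * y + 3 * D * x * y ^ 2 + D ^ 2 * y ^ 3)
      = (1 - e) * x ^ 2 + e ^ 3 := by
    rw [← htr, he]; ring
  have key : ((1 - e) * x + e ^ 2) ^ 2 - ((1 - e) * x ^ 2 + e ^ 3)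
      = -e * ((1 - e) * (x - e) ^ 2) := by ring
  have he1 : e < 1 := by nlinarith
  rw [h2, h3, gt_iff_lt, ← sub_pos, key]
  constructor
  · intro h
    by_contra hc
    have : 0 ≤ e := by
      by_contra hneg
      nlinarith
    have h4 : 0 ≤ (1 - e) * (x - e) ^ 2 := mul_nonneg (by linarith) (sq_nonneg _)
    nlinarith
  · intro h
    have hneg : e < 0 := by
      by_contra hc
      nlinarith
    have hxpos : 0 < x := by
      by_contra hc
      nlinarith
    have h5 : 0 < x - e := by linarith
    have h6 : 0 < 1 - e := by linarith
    have h7 : 0 < -e := by linarith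
    positivity
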